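/- Let n ≥ 2, M = Mₙ the n-fuse function, and tᵢ as usual. For every 0 ≤ i < n and every x ≥ 0, tᵢ(x)/i > M(x) (with t₀(x)/0 interpreted as +∞, i.e., the claim for i=0 is vacuous/trivially true). In particular t_{n-1}(x) > (n-1)·M(x) for all x ≥ 0. -/

import Mathlib

/-- Auxiliary values of the `n`-fuse function: `t₀(x) = 1`,
`t_{i+1}(x) = M(x - tᵢ(x))`. -/
def tfun (M : ℝ → ℝ) (x : ℝ) : ℕ → ℝ
  | 0 => 1
  | i + 1 => M (x - tfun M x i)

open Filter Topology Set

structure GoodPt (n : ℕ) (M : ℝ → ℝ) (x : ℝ) : Prop where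
  mono : ∀ y < x, y + M y ≤ x + M x
  q : 0 ≤ x → ∀ i < n, (i : ℝ) * M x < tfun M x i
  l : (∀ᶠ y in 𝓝[≤] x, M y = M x + x - y) ∨ Tendsto M (𝓝[<] x) (𝓝 0)
  r : ∀ᶠ y in 𝓝[≥] x, M y = M x + x - y

lemma tfun_pos' (M : ℝ → ℝ) (hpos : ∀ x : ℝ, 0 < M x) (x : ℝ) (i : ℕ) : 0 < tfun M x i := by
  cases i with
  | zero => simp [tfun]
  | succ i => exact hpos _

lemma goodPt_neg (n : ℕ) (M : ℝ → ℝ) (hneg : ∀ x : ℝ, x < 0 → M x = -x) (x : ℝ) (hx : x < 0) :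
    GoodPt n M x := by
  have h : ∀ᶠ y in 𝓝 x, M y = M x + x - y := by
    filter_upwards [gt_mem_nhds hx] with y hy
    rw [hneg y hy, hneg x hx]; ring
  refine ⟨?_, fun h => absurd h (not_le.2 hx), Or.inl (h.filter_mono nhdsWithin_le_nhds),
    h.filter_mono nhdsWithin_le_nhds⟩
  intro y hy
  rw [hneg y (hy.trans hx), hneg x hx]; simp

lemma aff_tendsto (x t : ℝ) (i : ℕ) :
    Tendsto (fun y : ℝ => y - (t - i * (y - x))) (𝓝 x) (𝓝 (x - t)) := by
  have : Continuous (fun y : ℝ => y - (t - i * (y - x))) := by fun_prop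
  simpa using this.tendsto x

lemma aff_ge (x t : ℝ) (i : ℕ) :
    Tendsto (fun y : ℝ => y - (t - i * (y - x))) (𝓝[≥] x) (𝓝[≥] (x - t)) := by
  refine tendsto_nhdsWithin_iff.2 ⟨(aff_tendsto x t i).mono_left nhdsWithin_le_nhds, ?_⟩
  filter_upwards [self_mem_nhdsWithin] with y (hy : x ≤ y)
  have : 0 ≤ (i : ℝ) * (y - x) := mul_nonneg (Nat.cast_nonneg _) (by linarith)
  simp only [mem_Ici]; linarith

lemma aff_le (x t : ℝ) (i : ℕ) :
    Tendsto (fun y : ℝ => y - (t - i * (y - x))) (𝓝[≤] x) (𝓝[≤] (x - t)) := by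
  refine tendsto_nhdsWithin_iff.2 ⟨(aff_tendsto x t i).mono_left nhdsWithin_le_nhds, ?_⟩
  filter_upwards [self_mem_nhdsWithin] with y (hy : y ≤ x)
  have : 0 ≤ (i : ℝ) * (x - y) := mul_nonneg (Nat.cast_nonneg _) (by linarith)
  simp only [mem_Iic]; linarith

lemma aff_lt (x t : ℝ) (i : ℕ) :
    Tendsto (fun y : ℝ => y - (t - i * (y - x))) (𝓝[<] x) (𝓝[<] (x - t)) := by
  refine tendsto_nhdsWithin_iff.2 ⟨(aff_tendsto x t i).mono_left nhdsWithin_le_nhds, ?_⟩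
  filter_upwards [self_mem_nhdsWithin] with y (hy : y < x)
  have : 0 ≤ (i : ℝ) * (x - y) := mul_nonneg (Nat.cast_nonneg _) (by linarith)
  simp only [mem_Iio]; linarith

lemma goodPt_step (n : ℕ) (hn : 2 ≤ n) (M : ℝ → ℝ)
    (hneg : ∀ x : ℝ, x < 0 → M x = -x)
    (heq : ∀ x : ℝ, 0 ≤ x → M x = tfun M x n / n)
    (hpos : ∀ x : ℝ, 0 < M x) (x : ℝ) (hx : 0 ≤ x) (ih : ∀ y < x, GoodPt n M y) :
    ∀ᶠ y in 𝓝[≥] x, GoodPt n M y := by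
  have hn0 : (0 : ℝ) < n := by exact_mod_cast (by omega : 0 < n)
  have ha : ∀ i, x - tfun M x i < x := fun i => by linarith [tfun_pos' M hpos x i]
  -- right structure
  have hRt : ∀ i : ℕ, ∀ᶠ y in 𝓝[≥] x, tfun M y i = tfun M x i - i * (y - x) := by
    intro i
    induction i with
    | zero => simp [tfun]
    | succ i hi =>
      have := (aff_ge x (tfun M x i) i).eventually (ih _ (ha i)).r
      filter_upwards [hi, this] with y h1 h2
      simp only [tfun]
      rw [h1, h2]; push_cast; ring
  have hR : ∀ᶠ y in 𝓝[≥] x, M y = M x + x - y := by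
    filter_upwards [hRt n, self_mem_nhdsWithin] with y h1 (h2 : x ≤ y)
    rw [heq y (hx.trans h2), heq x hx, h1]; field_simp; ring
  have key : (Tendsto M (𝓝[<] x) (𝓝 0)) ∨ (0 < x ∧
      ∀ i ≤ n, ∀ᶠ y in 𝓝[≤] x, tfun M y i = tfun M x i - i * (y - x)) := by
    by_cases hT : Tendsto M (𝓝[<] x) (𝓝 0)
    · exact Or.inl hT
    right
    have hx0 : 0 < x := by
      rcases hx.lt_or_eq with h | h
      · exact h
      exfalso; apply hT; subst h
      have h1 : Tendsto (fun y : ℝ => -y) (𝓝[<] 0) (𝓝 0) := by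
        have : Continuous (fun y : ℝ => -y) := by fun_prop
        simpa using (this.tendsto 0).mono_left (nhdsWithin_le_nhds (s := Iio (0:ℝ)))
      refine h1.congr' ?_
      filter_upwards [self_mem_nhdsWithin] with y hy
      exact (hneg y hy).symm
    refine ⟨hx0, ?_⟩
    intro i
    induction i with
    | zero => intro _; simp [tfun]
    | succ i hi =>
      intro hin
      have hi := hi (by omega)
      rcases (ih _ (ha i)).l with h | h
      · have := (aff_le x (tfun M x i) i).eventually h
        filter_upwards [hi, this] with y h1 h2
        simp only [tfun]
        rw [h1, h2]; push_cast; ring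
      · exfalso; apply hT
        have h3 := h.comp (aff_lt x (tfun M x i) i)
        have hi' := hi.filter_mono (nhdsWithin_mono x Iio_subset_Iic_self)
        have h0 : ∀ᶠ y in 𝓝[<] x, 0 < y := nhdsWithin_le_nhds (lt_mem_nhds hx0)
        refine tendsto_of_tendsto_of_tendsto_of_le_of_le' tendsto_const_nhds h3
          (Eventually.of_forall fun y => (hpos y).le) ?_
        filter_upwards [hi', h0, self_mem_nhdsWithin] with y h1 h2 (h4 : y < x)
        have e : (M ∘ fun y : ℝ => y - (tfun M x i - i * (y - x))) y = tfun M y (i+1) := by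
          simp only [tfun, Function.comp]; rw [h1]
        rw [e]
        have h5 : ((i + 1 : ℕ) : ℝ) * M y ≤ tfun M y (i+1) := by
          rcases hin.lt_or_eq with h6 | h6
          · exact ((ih y h4).q h2.le _ h6).le
          · rw [h6, heq y h2.le]; apply le_of_eq; field_simp
        push_cast at h5
        have : 0 ≤ (i:ℝ) * M y := mul_nonneg (Nat.cast_nonneg _) (hpos y).le
        linarith
  have hTm : Tendsto M (𝓝[<] x) (𝓝 0) → ∀ y < x, y + M y ≤ x := by
    intro hT y hy
    have h1 : Tendsto (fun z => z + M z) (𝓝[<] x) (𝓝 (x + 0)) :=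
      (tendsto_id.mono_left nhdsWithin_le_nhds).add hT
    rw [add_zero] at h1
    refine ge_of_tendsto h1 ?_
    have h0 : ∀ᶠ z in 𝓝[<] x, y < z := nhdsWithin_le_nhds (lt_mem_nhds hy)
    filter_upwards [h0, self_mem_nhdsWithin] with z h2 (h3 : z < x)
    exact (ih z h3).mono y h2
  have hL' : (∀ i ≤ n, ∀ᶠ y in 𝓝[≤] x, tfun M y i = tfun M x i - i * (y - x)) → 0 < x →
      ∀ᶠ y in 𝓝[≤] x, M y = M x + x - y := by
    intro h hx0
    have h0 : ∀ᶠ y in 𝓝[≤] x, 0 < y := nhdsWithin_le_nhds (lt_mem_nhds hx0)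
    filter_upwards [h n le_rfl, h0] with y h1 h2
    rw [heq y h2.le, heq x hx, h1]; field_simp; ring
  have hmono : ∀ y < x, y + M y ≤ x + M x := by
    intro y hy
    rcases key with h | ⟨hx0, h⟩
    · linarith [hTm h y hy, hpos x]
    · have h1 := (hL' h hx0).filter_mono (nhdsWithin_mono x Iio_subset_Iic_self)
      have h0 : ∀ᶠ z in 𝓝[<] x, y < z := nhdsWithin_le_nhds (lt_mem_nhds hy)
      have h2 : ∀ᶠ z in 𝓝[<] x, z < x := self_mem_nhdsWithin
      obtain ⟨z, ⟨hz1, hz2⟩, hz3⟩ := ((h1.and h0).and h2).exists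
      linarith [(ih z hz3).mono y hz2]
  have hq : ∀ i < n, (i : ℝ) * M x < tfun M x i := by
    intro i hi
    rcases key with h | ⟨hx0, h⟩
    · have hanti : Antitone (tfun M x) := antitone_nat_of_succ_le fun j => by
        have := hTm h _ (ha j)
        simp only [tfun]; linarith
      have h1 := hanti hi.le
      have h2 : tfun M x n = n * M x := by rw [heq x hx]; field_simp
      have h3 : (i : ℝ) < n := by exact_mod_cast hi
      have := mul_lt_mul_of_pos_right h3 (hpos x)
      linarith
    · have h1 := (hL' h hx0).filter_mono (nhdsWithin_mono x Iio_subset_Iic_self)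
      have h2 := (h i hi.le).filter_mono (nhdsWithin_mono x Iio_subset_Iic_self)
      have h0 : ∀ᶠ z in 𝓝[<] x, 0 < z := nhdsWithin_le_nhds (lt_mem_nhds hx0)
      have h3 : ∀ᶠ z in 𝓝[<] x, z < x := self_mem_nhdsWithin
      obtain ⟨z, ⟨⟨hz1, hz2⟩, hz3⟩, hz4⟩ := (((h1.and h2).and h0).and h3).exists
      have := (ih z hz4).q hz3.le i hi
      rw [hz1, hz2] at this
      linarith
  have hL : (∀ᶠ y in 𝓝[≤] x, M y = M x + x - y) ∨ Tendsto M (𝓝[<] x) (𝓝 0) := by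
    rcases key with h | ⟨hx0, h⟩
    · exact Or.inr h
    · exact Or.inl (hL' h hx0)
  have hG : GoodPt n M x := ⟨hmono, fun _ => hq, hL, hR⟩
  -- extend to the right
  obtain ⟨u, hu, hS⟩ := (mem_nhdsGE_iff_exists_Ico_subset).1 hR
  have hall : ∀ᶠ y in 𝓝[≥] x, ∀ i ∈ Finset.range n, tfun M y i = tfun M x i - i * (y - x) :=
    (Finset.eventually_all _).2 fun i _ => hRt i
  have hu' : ∀ᶠ y in 𝓝[≥] x, y < u := nhdsWithin_le_nhds (gt_mem_nhds hu)
  filter_upwards [hall, hu', self_mem_nhdsWithin] with y h1 h2 (h3 : x ≤ y)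
  rcases h3.eq_or_lt with h | h3'
  · exact h ▸ hG
  have hy : M y = M x + x - y := hS ⟨h3, h2⟩
  have hloc : ∀ᶠ z in 𝓝 y, M z = M y + y - z := by
    filter_upwards [gt_mem_nhds h2, lt_mem_nhds h3'] with z hz1 hz2
    have : M z = M x + x - z := hS ⟨hz2.le, hz1⟩
    rw [this, hy]; ring
  refine ⟨?_, ?_, Or.inl (hloc.filter_mono nhdsWithin_le_nhds),
    hloc.filter_mono nhdsWithin_le_nhds⟩
  · intro z hz
    rcases lt_or_ge z x with h | h
    · linarith [hmono z h]
    · have : M z = M x + x - z := hS ⟨h, hz.trans h2⟩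
      linarith
  · intro _ i hi
    rw [h1 i (Finset.mem_range.2 hi), hy]
    linarith [hq i hi]

lemma goodPt_all (n : ℕ) (hn : 2 ≤ n) (M : ℝ → ℝ)
    (hneg : ∀ x : ℝ, x < 0 → M x = -x)
    (heq : ∀ x : ℝ, 0 ≤ x → M x = tfun M x n / n)
    (hpos : ∀ x : ℝ, 0 < M x) (x : ℝ) : GoodPt n M x := by
  by_contra hx
  set B := {y | ¬ GoodPt n M y} with hB
  have hne : B.Nonempty := ⟨x, hx⟩
  have hlb : ∀ b ∈ B, 0 ≤ b := fun b hb => by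
    by_contra h
    exact hb (goodPt_neg n M hneg b (not_le.1 h))
  have hbdd : BddBelow B := ⟨0, hlb⟩
  have h0 : 0 ≤ sInf B := le_csInf hne hlb
  have h := goodPt_step n hn M hneg heq hpos (sInf B) h0 fun y hy => by
    by_contra h
    exact absurd (csInf_le hbdd h) (not_le.2 hy)
  obtain ⟨u, hu, hS⟩ := (mem_nhdsGE_iff_exists_Ico_subset).1 h
  obtain ⟨b, hb, hbu⟩ := exists_lt_of_csInf_lt hne hu
  exact hb (hS ⟨csInf_le hbdd hb, hbu⟩)

/-- For the total, positive-valued `n`-fuse function `Mₙ`: for every `x ≥ 0`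
and every `1 ≤ i < n` we have `Uᵢ(x) = tᵢ(x)/i > Mₙ(x)` (the case `i = 0`,
with `U₀(x) = +∞`, being trivial).  In particular
`t_{n-1}(x) > (n-1)·Mₙ(x)`. -/
theorem Mn_U_gt (n : ℕ) (hn : 2 ≤ n) (M : ℝ → ℝ)
    (hneg : ∀ x : ℝ, x < 0 → M x = -x)
    (heq : ∀ x : ℝ, 0 ≤ x → M x = tfun M x n / n)
    (hpos : ∀ x : ℝ, 0 < M x)
    (x : ℝ) (hx : 0 ≤ x) :
    (∀ i : ℕ, 1 ≤ i → i < n → M x < tfun M x i / (i : ℝ)) ∧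
    ((n : ℝ) - 1) * M x < tfun M x (n - 1) := by
  have h := (goodPt_all n hn M hneg heq hpos x).q hx
  constructor
  · intro i hi hin
    have hi0 : (0 : ℝ) < i := by exact_mod_cast hi
    rw [lt_div_iff₀ hi0, mul_comm]
    exact h i hin
  · have := h (n - 1) (by omega)
    rwa [Nat.cast_sub (by omega), Nat.cast_one] at this
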